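/- Let p ~ N(μ_p, σ_p², a, b) and q ~ N(μ_q, σ_q², c, d) be truncated normal distributions with σ_p, σ_q > 0, a < b, c < d, whose supports overlap, i.e. l < u where l = max(a, c) and u = min(b, d). Then the Bhattacharyya distance D_BC-TN(p,q) = −ln ∫ √(f_p(x) f_q(x)) dx equals (1/4)((μ_p − μ_q)²/(σ_p² + σ_q²)) + (1/4) ln( (1/4)(σ_p²/σ_q² + σ_q²/σ_p² + 2) ) + (1/2) ln[ Φ((b−μ_p)/σ_p) − Φ((a−μ_p)/σ_p) ] + (1/2) ln[ Φ((d−μ_q)/σ_q) − Φ((c−μ_q)/σ_q) ] − ln{ Φ((u−ν)/ς) − Φ((l−ν)/ς) }, where ν = (μ_p σ_q² + μ_q σ_p²)/(σ_p² + σ_q²) and ς = √( 2 σ_p² σ_q² / (σ_p² + σ_q²) ). -/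

import Mathlib

open MeasureTheory Real

/-- The standard normal density `φ(ξ) = (1/√(2π)) exp(−ξ²/2)`. -/
noncomputable def stdNormalPdf (x : ℝ) : ℝ :=
  (1 / Real.sqrt (2 * Real.pi)) * Real.exp (-x ^ 2 / 2)

/-- The standard normal cumulative distribution function `Φ`. -/
noncomputable def stdNormalCdf (x : ℝ) : ℝ :=
  ∫ t in Set.Iio x, stdNormalPdf t

/-- The density of the truncated normal distribution `N(μ, σ², a, b)`:
`f(x) = (1/σ) φ((x−μ)/σ) / (Φ((b−μ)/σ) − Φ((a−μ)/σ))` for `a ≤ x ≤ b`, `0` otherwise. -/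
noncomputable def truncNormalPdf (μ σ a b x : ℝ) : ℝ :=
  if a ≤ x ∧ x ≤ b then
    (1 / σ) * stdNormalPdf ((x - μ) / σ) /
      (stdNormalCdf ((b - μ) / σ) - stdNormalCdf ((a - μ) / σ))
  else 0

theorem stdNormalPdf_cont : Continuous stdNormalPdf := by
  unfold stdNormalPdf
  fun_prop

theorem stdNormalPdf_pos (x : ℝ) : 0 < stdNormalPdf x := by
  unfold stdNormalPdf
  positivity

theorem stdNormalPdf_int : Integrable stdNormalPdf := by
  have h := (integrable_exp_neg_mul_sq (b := 1 / 2) (by norm_num)).const_mul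
    (1 / Real.sqrt (2 * Real.pi))
  refine h.congr (Filter.Eventually.of_forall fun x => ?_)
  simp only [stdNormalPdf]
  congr 2
  ring

theorem stdNormalCdf_sub (x y : ℝ) :
    stdNormalCdf y - stdNormalCdf x = ∫ t in x..y, stdNormalPdf t := by
  unfold stdNormalCdf
  rw [← integral_Iic_eq_integral_Iio, ← integral_Iic_eq_integral_Iio]
  exact intervalIntegral.integral_Iic_sub_Iic stdNormalPdf_int.integrableOn
    stdNormalPdf_int.integrableOn

theorem stdNormalCdf_sub_pos {x y : ℝ} (h : x < y) :
    0 < stdNormalCdf y - stdNormalCdf x := by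
  rw [stdNormalCdf_sub]
  exact intervalIntegral.intervalIntegral_pos_of_pos
    (stdNormalPdf_cont.intervalIntegrable _ _) stdNormalPdf_pos h

theorem bc_key (μp μq σp σq Zp Zq ν ς x : ℝ) (hσp : 0 < σp) (hσq : 0 < σq)
    (hZp : 0 < Zp) (hZq : 0 < Zq)
    (hν : ν = (μp * σq ^ 2 + μq * σp ^ 2) / (σp ^ 2 + σq ^ 2))
    (hς2 : ς ^ 2 = 2 * σp ^ 2 * σq ^ 2 / (σp ^ 2 + σq ^ 2)) :
    Real.sqrt ((1 / σp) * stdNormalPdf ((x - μp) / σp) / Zp *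
      ((1 / σq) * stdNormalPdf ((x - μq) / σq) / Zq)) =
    (Real.exp (-(1 / 4 * ((μp - μq) ^ 2 / (σp ^ 2 + σq ^ 2)))) /
      Real.sqrt (σp * σq * Zp * Zq)) * stdNormalPdf ((x - ν) / ς) := by
  have hpi := stdNormalPdf_pos ((x - ν) / ς)
  rw [Real.sqrt_eq_iff_mul_self_eq_of_pos (by positivity)]
  have hs : Real.sqrt (σp * σq * Zp * Zq) * Real.sqrt (σp * σq * Zp * Zq) = σp * σq * Zp * Zq :=
    Real.mul_self_sqrt (by positivity)
  have hexp : Real.exp (-((x - μp) / σp) ^ 2 / 2) * Real.exp (-((x - μq) / σq) ^ 2 / 2) =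
      (Real.exp (-(1 / 4 * ((μp - μq) ^ 2 / (σp ^ 2 + σq ^ 2)))) *
        Real.exp (-((x - ν) / ς) ^ 2 / 2)) * (Real.exp (-(1 / 4 * ((μp - μq) ^ 2 / (σp ^ 2 + σq ^ 2)))) *
        Real.exp (-((x - ν) / ς) ^ 2 / 2)) := by
    simp only [← Real.exp_add]
    congr 1
    rw [div_pow (x - ν), hς2, hν]
    field_simp
    ring
  unfold stdNormalPdf
  generalize Real.sqrt (σp * σq * Zp * Zq) = s at *
  have hs0 : s ≠ 0 := by
    rintro rfl
    have : 0 < σp * σq * Zp * Zq := by positivity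
    linarith
  have e : (1 / σp) * ((1 / Real.sqrt (2 * Real.pi)) * Real.exp (-((x - μp) / σp) ^ 2 / 2)) / Zp *
      ((1 / σq) * ((1 / Real.sqrt (2 * Real.pi)) * Real.exp (-((x - μq) / σq) ^ 2 / 2)) / Zq)
      = (1 / Real.sqrt (2 * Real.pi)) ^ 2 * (Real.exp (-((x - μp) / σp) ^ 2 / 2) *
        Real.exp (-((x - μq) / σq) ^ 2 / 2)) / (σp * σq * Zp * Zq) := by
    field_simp
  rw [e, hexp, ← hs]
  field_simp

/-- The Bhattacharyya distance between two overlapping truncated normal distributions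
`p ~ N(μp, σp², a, b)` and `q ~ N(μq, σq², c, d)`. -/
theorem bhattacharyya_distance_truncated_normal_overlap
    (μp μq σp σq a b c d : ℝ) (hσp : 0 < σp) (hσq : 0 < σq)
    (hab : a < b) (hcd : c < d)
    (l u ν ς : ℝ)
    (hl : l = max a c) (hu : u = min b d) (hlu : l < u)
    (hν : ν = (μp * σq ^ 2 + μq * σp ^ 2) / (σp ^ 2 + σq ^ 2))
    (hς : ς = Real.sqrt (2 * σp ^ 2 * σq ^ 2 / (σp ^ 2 + σq ^ 2))) :
    -Real.log (∫ x : ℝ,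
        Real.sqrt (truncNormalPdf μp σp a b x * truncNormalPdf μq σq c d x)) =
      1 / 4 * ((μp - μq) ^ 2 / (σp ^ 2 + σq ^ 2)) +
        1 / 4 * Real.log (1 / 4 * (σp ^ 2 / σq ^ 2 + σq ^ 2 / σp ^ 2 + 2)) +
          1 / 2 * Real.log (stdNormalCdf ((b - μp) / σp) - stdNormalCdf ((a - μp) / σp)) +
            1 / 2 * Real.log (stdNormalCdf ((d - μq) / σq) - stdNormalCdf ((c - μq) / σq)) -
              Real.log (stdNormalCdf ((u - ν) / ς) - stdNormalCdf ((l - ν) / ς)) := by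
  have hS : 0 < σp ^ 2 + σq ^ 2 := by positivity
  have hς0 : 0 < ς := by rw [hς]; positivity
  have hς2 : ς ^ 2 = 2 * σp ^ 2 * σq ^ 2 / (σp ^ 2 + σq ^ 2) := by
    rw [hς]; exact Real.sq_sqrt (by positivity)
  have hZp := stdNormalCdf_sub_pos (x := (a - μp) / σp) (y := (b - μp) / σp) (by gcongr)
  have hZq := stdNormalCdf_sub_pos (x := (c - μq) / σq) (y := (d - μq) / σq) (by gcongr)
  have hZ := stdNormalCdf_sub_pos (x := (l - ν) / ς) (y := (u - ν) / ς) (by gcongr)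
  have hsub := stdNormalCdf_sub ((l - ν) / ς) ((u - ν) / ς)
  have hkey := fun x => bc_key μp μq σp σq _ _ ν ς x hσp hσq hZp hZq hν hς2
  have hint : (∫ x : ℝ,
        Real.sqrt (truncNormalPdf μp σp a b x * truncNormalPdf μq σq c d x)) =
      ∫ x in l..u, (Real.exp (-(1 / 4 * ((μp - μq) ^ 2 / (σp ^ 2 + σq ^ 2)))) /
      Real.sqrt (σp * σq * (stdNormalCdf ((b - μp) / σp) - stdNormalCdf ((a - μp) / σp)) *
        (stdNormalCdf ((d - μq) / σq) - stdNormalCdf ((c - μq) / σq)))) *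
          stdNormalPdf ((x - ν) / ς) := by
    rw [intervalIntegral.integral_of_le hlu.le, ← integral_Icc_eq_integral_Ioc,
      ← integral_indicator measurableSet_Icc]
    congr 1
    funext x
    by_cases hx : x ∈ Set.Icc l u
    · rw [Set.indicator_of_mem hx, ← hkey x]
      have h1 := hx.1
      have h2 := hx.2
      rw [hl, max_le_iff] at h1
      rw [hu, le_min_iff] at h2
      unfold truncNormalPdf
      rw [if_pos ⟨h1.1, h2.1⟩, if_pos ⟨h1.2, h2.2⟩]
    · rw [Set.indicator_of_notMem hx]
      unfold truncNormalPdf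
      by_cases hp : a ≤ x ∧ x ≤ b
      · by_cases hq : c ≤ x ∧ x ≤ d
        · exact absurd ⟨by rw [hl]; exact max_le hp.1 hq.1,
            by rw [hu]; exact le_min hp.2 hq.2⟩ hx
        · rw [if_neg hq]; simp
      · rw [if_neg hp]; simp
  have hcv : ∫ x in l..u, stdNormalPdf ((x - ν) / ς) =
      ς * (stdNormalCdf ((u - ν) / ς) - stdNormalCdf ((l - ν) / ς)) := by
    rw [hsub]
    have h := intervalIntegral.integral_comp_div_sub (a := l) (b := u) stdNormalPdf hς0.ne' (ν / ς)
    simp only [← sub_div, smul_eq_mul] at h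
    exact h
  rw [hint, intervalIntegral.integral_const_mul, hcv]
  generalize stdNormalCdf ((b - μp) / σp) - stdNormalCdf ((a - μp) / σp) = Zp at *
  generalize stdNormalCdf ((d - μq) / σq) - stdNormalCdf ((c - μq) / σq) = Zq at *
  generalize stdNormalCdf ((u - ν) / ς) - stdNormalCdf ((l - ν) / ς) = Z at *
  have hςlog : Real.log ς = 1 / 2 * (Real.log 2 + 2 * Real.log σp + 2 * Real.log σq
      - Real.log (σp ^ 2 + σq ^ 2)) := by
    rw [hς, Real.log_sqrt (by positivity), Real.log_div (by positivity) (by positivity),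
      Real.log_mul (by positivity) (by positivity), Real.log_mul (by positivity) (by positivity),
      Real.log_pow, Real.log_pow]
    push_cast
    ring
  have hl2 : Real.log (1 / 4 * (σp ^ 2 / σq ^ 2 + σq ^ 2 / σp ^ 2 + 2)) =
      2 * (Real.log (σp ^ 2 + σq ^ 2) - Real.log 2 - Real.log σp - Real.log σq) := by
    have : 1 / 4 * (σp ^ 2 / σq ^ 2 + σq ^ 2 / σp ^ 2 + 2) =
        ((σp ^ 2 + σq ^ 2) / (2 * σp * σq)) ^ 2 := by
      field_simp
      ring
    rw [this, Real.log_pow, Real.log_div (by positivity) (by positivity),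
      Real.log_mul (by positivity) (by positivity), Real.log_mul (by positivity) (by positivity)]
    push_cast
    ring
  rw [hl2, Real.log_mul (by positivity) (by positivity),
    Real.log_div (by positivity) (by positivity), Real.log_exp,
    Real.log_mul hς0.ne' (by positivity), hςlog, Real.log_sqrt (by positivity),
    Real.log_mul (by positivity) (by positivity), Real.log_mul (by positivity) (by positivity),
    Real.log_mul (by positivity) (by positivity)]
  ring
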